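/- Let k be a perfect field of characteristic p > 0, let S = ⊕_{i≥0} S_i be a commutative ℕ-graded ring with S_0 = k generated as a k-algebra by finitely many elements of S_1, let 𝔪 = S_+, fix e ≥ 1 and set q = p^e. For each n ∈ {0,…,q−1}, let S^{(n)} = ⊕_{i≥0} S_{iq+n}, regarded as an S-module via the e-th Frobenius, i.e., with action s · x = s^q x for s ∈ S and x ∈ S^{(n)}. Then S_𝔪 is a regular local ring if and only if for every n ∈ {0,…,q−1} the S-module S^{(n)} is free on a basis consisting of homogeneous elements of S. -/

import Mathlib

/-- A Noetherian local ring is regular if its maximal ideal can be generated by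
`dim R` many elements. -/
def IsRegularLocal (R : Type*) [CommRing R] [IsLocalRing R] : Prop :=
  IsNoetherianRing R ∧
    ∃ s : Finset R, Ideal.span (s : Set R) = IsLocalRing.maximalIdeal R ∧
      ringKrullDim R = (s.card : WithBot ℕ∞)

namespace GK

def LechIndep {σ S : Type*} [Fintype σ] [CommRing S] (y : σ → S) : Prop :=
  ∀ a : σ → S, ∑ i, a i * y i = 0 → ∀ i, a i ∈ Ideal.span (Set.range y)

lemma LechIndep.update {σ S : Type*} [Fintype σ] [DecidableEq σ] [CommRing S] {y : σ → S}
    (h : LechIndep y) (j : σ) (u v : S) (hy : y j = u * v) :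
    LechIndep (Function.update y j u) := by
  intro a ha
  have hu : u ∈ Ideal.span (Set.range (Function.update y j u)) :=
    Ideal.subset_span ⟨j, by simp⟩
  have hle : Ideal.span (Set.range y) ≤ Ideal.span (Set.range (Function.update y j u)) := by
    rw [Ideal.span_le]
    rintro _ ⟨i, rfl⟩
    by_cases hij : i = j
    · subst hij
      rw [hy]
      exact Ideal.mul_mem_right _ _ hu
    · exact Ideal.subset_span ⟨i, by simp [hij]⟩
  have h1 := h (Function.update (fun i => v * a i) j (a j)) (by
    rw [← mul_zero v, ← ha, Finset.mul_sum]
    refine Finset.sum_congr rfl fun i _ => ?_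
    by_cases hij : i = j
    · subst hij; simp [hy]; ring
    · simp [hij]; ring) j
  simp only [Function.update_self] at h1
  obtain ⟨c, hc⟩ := (Ideal.mem_span_range_iff_exists_fun).1 h1
  have h2 := h (fun i => u * c i + if i = j then 0 else a i) (by
    have : ∑ i, (u * c i) * y i = u * a j := by
      rw [← hc, Finset.mul_sum]; exact Finset.sum_congr rfl fun i _ => by ring
    simp only [add_mul, Finset.sum_add_distrib, this]
    refine Eq.trans ?_ ha
    rw [Fintype.sum_eq_add_sum_compl j (fun i => (if i = j then 0 else a i) * y i),
      Fintype.sum_eq_add_sum_compl j (fun i => a i * Function.update y j u i)]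
    simp only [if_true, Function.update_self, zero_mul, zero_add]
    rw [mul_comm u]
    congr 1
    refine Finset.sum_congr rfl fun i hi => ?_
    have : i ≠ j := by simpa using hi
    simp [this])
  intro i
  by_cases hij : i = j
  · subst hij; exact hle h1
  · have := hle (h2 i)
    simp only [hij, if_false] at this
    exact (Ideal.add_mem_iff_right _ (Ideal.mul_mem_right _ _ hu)).1 this

lemma LechIndep.pow {σ S : Type*} [Fintype σ] [CommRing S] {x : σ → S} {Q : ℕ}
    (h : LechIndep (fun i => x i ^ Q)) (e : σ → ℕ) (he : ∀ i, e i ≤ Q) :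
    LechIndep (fun i => x i ^ e i) := by
  classical
  suffices H : ∀ T : Finset σ, LechIndep (fun i => x i ^ (if i ∈ T then e i else Q)) by
    simpa using H Finset.univ
  intro T
  induction T using Finset.induction_on with
  | empty => simpa using h
  | insert j T hj ih =>
    have := ih.update j (x j ^ e j) (x j ^ (Q - e j)) (by
      simp [hj, ← pow_add, Nat.add_sub_of_le (he j)])
    convert this using 1
    ext i
    by_cases hij : i = j
    · subst hij; simp
    · simp [hij]

lemma mono_step {σ S : Type*} [Fintype σ] [DecidableEq σ] [CommRing S] {x : σ → S}
    (h : ∀ e : σ → ℕ, LechIndep (fun i => x i ^ e i)) (a : σ → ℕ) (j : σ)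
    (ha : ∏ i, x i ^ a i ∈ Ideal.span (Set.range fun i => x i ^ (a i + 1))) :
    ∏ i, x i ^ (Function.update a j 0 i) ∈
      Ideal.span (Set.range fun i => x i ^ (Function.update a j 0 i + 1)) := by
  by_cases haj : a j = 0
  · rwa [← haj, Function.update_eq_self]
  obtain ⟨c, hc⟩ := (Ideal.mem_span_range_iff_exists_fun).1 ha
  set M := ∏ i, x i ^ (Function.update a j 0 i) with hM
  have hprod : ∏ i, x i ^ a i = x j ^ a j * M := by
    rw [hM, Fintype.prod_eq_mul_prod_compl j, Fintype.prod_eq_mul_prod_compl j]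
    simp only [Function.update_self, pow_zero, one_mul]
    congr 1
    refine Finset.prod_congr rfl fun i hi => ?_
    have : i ≠ j := by simpa using hi
    simp [this]
  have key := h (Function.update (fun i => a i + 1) j (a j))
    (fun i => if i = j then M - c j * x j else - c i) (by
      rw [Fintype.sum_eq_add_sum_compl j]
      simp only [Function.update_self, if_true]
      rw [hprod, Fintype.sum_eq_add_sum_compl j] at hc
      have : ∑ i ∈ {j}ᶜ, (if i = j then M - c j * x j else - c i) *
          x i ^ Function.update (fun i => a i + 1) j (a j) i =
          - ∑ i ∈ {j}ᶜ, c i * x i ^ (a i + 1) := by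
        rw [← Finset.sum_neg_distrib]
        refine Finset.sum_congr rfl fun i hi => ?_
        have : i ≠ j := by simpa using hi
        simp [this]
      rw [this]
      linear_combination -hc) j
  simp only [if_true] at key
  set J := Ideal.span (Set.range fun i => x i ^ (Function.update a j 0 i + 1)) with hJ
  have hxj : x j ∈ J := Ideal.subset_span ⟨j, by simp⟩
  have hle : Ideal.span (Set.range fun i => x i ^ Function.update (fun i => a i + 1) j (a j) i)
      ≤ J := by
    rw [Ideal.span_le]
    rintro _ ⟨i, rfl⟩
    by_cases hij : i = j
    · subst hij
      simp only [Function.update_self]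
      exact Ideal.pow_mem_of_mem _ hxj _ (Nat.pos_of_ne_zero haj)
    · exact Ideal.subset_span ⟨i, by simp [hij]⟩
  have := hle key
  simpa using J.add_mem this (Ideal.mul_mem_left _ (c j) hxj)

lemma mono_not_mem {σ S : Type*} [Fintype σ] [CommRing S] {x : σ → S}
    (h : ∀ e : σ → ℕ, LechIndep (fun i => x i ^ e i)) (a : σ → ℕ)
    (ha : ∏ i, x i ^ a i ∈ Ideal.span (Set.range fun i => x i ^ (a i + 1))) :
    (1 : S) ∈ Ideal.span (Set.range x) := by
  classical
  have H : ∀ T : Finset σ, ∏ i, x i ^ (if i ∈ T then 0 else a i) ∈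
      Ideal.span (Set.range fun i => x i ^ ((if i ∈ T then 0 else a i) + 1)) := by
    intro T
    induction T using Finset.induction_on with
    | empty => simpa using ha
    | insert j T hj ih =>
      have := mono_step h _ j ih
      have e : (Function.update (fun i => if i ∈ T then 0 else a i) j 0) =
          fun i => if i ∈ insert j T then 0 else a i := by
        ext i
        by_cases hij : i = j
        · subst hij; simp
        · simp [hij]
      simpa only [e] using this
  simpa using H Finset.univ

lemma aeval_inj {k σ S : Type*} [Field k] [Fintype σ] [CommRing S] [Algebra k S] {x : σ → S}
    (h : ∀ e : σ → ℕ, LechIndep (fun i => x i ^ e i)) (h1 : (1 : S) ∉ Ideal.span (Set.range x)) :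
    Function.Injective (MvPolynomial.aeval x : MvPolynomial σ k →ₐ[k] S) := by
  classical
  rw [injective_iff_map_eq_zero]
  intro f hf
  by_contra hne
  obtain ⟨a, ha, hmin⟩ := Finset.exists_min_image f.support (fun a => ∑ i, a i)
    (MvPolynomial.support_nonempty.2 hne)
  apply h1
  apply mono_not_mem h a
  have hca : f.coeff a ≠ 0 := MvPolynomial.mem_support_iff.1 ha
  rw [MvPolynomial.aeval_def, MvPolynomial.eval₂_eq', ← Finset.add_sum_erase _ _ ha] at hf
  set J := Ideal.span (Set.range fun i => x i ^ (a i + 1)) with hJ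
  have h2 : ∑ b ∈ f.support.erase a, algebraMap k S (f.coeff b) * ∏ i, x i ^ b i ∈ J := by
    refine Ideal.sum_mem _ fun b hb => Ideal.mul_mem_left _ _ ?_
    rw [Finset.mem_erase] at hb
    have : ∃ i, a i < b i := by
      by_contra! hcon
      apply hb.1
      have h3 := (Finset.sum_eq_sum_iff_of_le (fun i _ => hcon i)).1
        (le_antisymm (Finset.sum_le_sum fun i _ => hcon i) (hmin b hb.2))
      ext i
      exact h3 i (Finset.mem_univ i)
    obtain ⟨i, hi⟩ := this
    refine Ideal.mem_of_dvd _ ((pow_dvd_pow (x i) hi).trans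
      (Finset.dvd_prod_of_mem _ (Finset.mem_univ i))) (Ideal.subset_span ⟨i, rfl⟩)
  have h3 : algebraMap k S (f.coeff a) * ∏ i, x i ^ a i ∈ J := by
    rw [eq_neg_of_add_eq_zero_left hf]; exact J.neg_mem h2
  have := J.mul_mem_left (algebraMap k S (f.coeff a)⁻¹) h3
  rwa [← mul_assoc, ← map_mul, inv_mul_cancel₀ hca, map_one, one_mul] at this


universe u v

lemma flat_rel {R T : Type*} [CommRing R] [CommRing T] (F : R →+* T) (hF : F.Flat) {σ : Type*}
    [Fintype σ] (f : σ → R) (a : σ → T) (h : ∑ i, F (f i) * a i = 0) :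
    ∃ (n : ℕ) (A : σ → Fin n → R) (y : Fin n → T), (∀ i, a i = ∑ j, F (A i j) * y j) ∧
      ∀ j, ∑ i, f i * A i j = 0 := by
  algebraize [F]
  obtain ⟨n, A, y, h1, h2⟩ := Module.Flat.isTrivialRelation_of_sum_smul_eq_zero
    (R := R) (M := T) (f := f) (x := a) (by simpa [Algebra.smul_def] using! h)
  exact ⟨n, A, y, fun i => by rw [h1 i]; simp [Algebra.smul_def]; rfl, h2⟩

lemma flat_of_basis {R T : Type*} [CommRing R] [CommRing T] (F : R →+* T) {κ : Type*} (b : κ → T)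
    (hs : ∀ x : T, ∃ f : κ →₀ R, x = f.sum fun t c => F c * b t)
    (hi : ∀ f : κ →₀ R, (f.sum fun t c => F c * b t) = 0 → f = 0) : F.Flat := by
  let := F.toAlgebra
  have e : ∀ f : κ →₀ R, Finsupp.linearCombination R b f = f.sum fun t c => F c * b t := by
    intro f
    rw [Finsupp.linearCombination_apply]
    rfl
  have hbij : Function.Bijective (Finsupp.linearCombination R b) := by
    constructor
    · rw [injective_iff_map_eq_zero]
      intro f hf
      exact hi f (by rw [← e, hf])
    · intro x
      obtain ⟨f, hf⟩ := hs x
      exact ⟨f, by rw [e, hf]⟩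
  exact Module.Flat.of_linearEquiv (LinearEquiv.ofBijective _ hbij).symm

lemma exists_gens {k : Type u} {S : Type v} [Field k] [CommRing S] [Algebra k S]
    (𝒜 : ℕ → Submodule k S)
    (hgen : ∃ s : Finset S, (s : Set S) ⊆ (𝒜 1 : Set S) ∧ Algebra.adjoin k (s : Set S) = ⊤) :
    ∃ (σ : Type v) (_ : Fintype σ) (x : σ → S), (∀ i, x i ∈ 𝒜 1) ∧ LinearIndependent k x ∧
      Algebra.adjoin k (Set.range x) = ⊤ := by
  classical
  obtain ⟨s, hs, hadj⟩ := hgen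
  obtain ⟨b, hb, hspan, hli⟩ := exists_linearIndependent k (s : Set S)
  have hfin : b.Finite := s.finite_toSet.subset hb
  refine ⟨b, hfin.fintype, (↑), fun i => hs (hb i.2), hli, ?_⟩
  rw [Subtype.range_coe, ← Algebra.adjoin_span, hspan, Algebra.adjoin_span, hadj]

section
variable {k : Type u} {S : Type v} [Field k] [CommRing S] [Algebra k S]
    {𝒜 : ℕ → Submodule k S} [GradedAlgebra 𝒜] {σ : Type*} {x : σ → S}

lemma aeval_surj (hadj : Algebra.adjoin k (Set.range x) = ⊤) :
    Function.Surjective (MvPolynomial.aeval x : MvPolynomial σ k →ₐ[k] S) := by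
  rw [← AlgHom.range_eq_top, ← hadj, Algebra.adjoin_range_eq_range_aeval]

lemma m_eq_span (hx : ∀ i, x i ∈ 𝒜 1)
    (hadj : Algebra.adjoin k (Set.range x) = ⊤)
    (m : Ideal S) (hm : m = (HomogeneousIdeal.irrelevant 𝒜).toIdeal) (hmax : m.IsMaximal) :
    m = Ideal.span (Set.range x) := by
  have hle : Ideal.span (Set.range x) ≤ m := by
    rw [Ideal.span_le]
    rintro _ ⟨i, rfl⟩
    rw [hm]
    exact HomogeneousIdeal.mem_irrelevant_of_mem 𝒜 (i := 1) one_pos (hx i)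
  refine le_antisymm ?_ hle
  have key : ∀ f : MvPolynomial σ k, ∃ c : k,
      MvPolynomial.aeval x f - algebraMap k S c ∈ Ideal.span (Set.range x) := by
    intro f
    induction f using MvPolynomial.induction_on with
    | C a => exact ⟨a, by simp⟩
    | add f g hf hg =>
      obtain ⟨c, hc⟩ := hf
      obtain ⟨d, hd⟩ := hg
      refine ⟨c + d, ?_⟩
      have := Ideal.add_mem _ hc hd
      rw [map_add, map_add]
      convert this using 1
      ring
    | mul_X f i hf =>
      refine ⟨0, ?_⟩
      rw [map_mul, MvPolynomial.aeval_X, map_zero, sub_zero]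
      exact Ideal.mul_mem_left _ _ (Ideal.subset_span ⟨i, rfl⟩)
  intro s hs
  obtain ⟨f, rfl⟩ := aeval_surj hadj s
  obtain ⟨c, hc⟩ := key f
  have hcm : algebraMap k S c ∈ m := by
    have := m.sub_mem hs (hle hc)
    simpa using this
  by_cases hc0 : c = 0
  · simpa [hc0] using hc
  · exact absurd (m.eq_top_of_isUnit_mem hcm ((IsUnit.mk0 c hc0).map _)) hmax.ne_top

/-- a linear dependence among degree one elements -/
lemma proj_one_mul {a y : S} (hy : y ∈ 𝒜 1) :
    GradedRing.proj 𝒜 1 (a * y) = GradedRing.proj 𝒜 0 a * y := by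
  have := DirectSum.coe_decompose_mul_add_of_right_mem 𝒜 (i := 0) (j := 1) (a := a) hy
  simpa using this

lemma exists_proj_zero (h0 : 𝒜 0 = (1 : Submodule k S)) (a : S) :
    ∃ c : k, GradedRing.proj 𝒜 0 a = algebraMap k S c := by
  have : GradedRing.proj 𝒜 0 a ∈ 𝒜 0 := SetLike.coe_mem _
  rw [h0, Submodule.mem_one] at this
  obtain ⟨c, hc⟩ := this
  exact ⟨c, hc.symm⟩

lemma coeff_mem [Fintype σ] (h0 : 𝒜 0 = (1 : Submodule k S)) (hx : ∀ i, x i ∈ 𝒜 1)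
    (hli : LinearIndependent k x)
    (m : Ideal S) (hm : m = (HomogeneousIdeal.irrelevant 𝒜).toIdeal)
    (a : σ → S) (ha : ∑ i, x i * a i = 0) (i : σ) : a i ∈ m := by
  choose c hc using fun i => exists_proj_zero (𝒜 := 𝒜) h0 (a i)
  have h1 : ∑ i, c i • x i = 0 := by
    rw [← map_zero (GradedRing.proj 𝒜 1), ← ha, map_sum]
    refine Finset.sum_congr rfl fun i _ => ?_
    rw [mul_comm, proj_one_mul (hx i), hc, Algebra.smul_def]
  have := Fintype.linearIndependent_iff.1 hli c h1 i
  rw [hm]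
  change a i ∈ HomogeneousIdeal.irrelevant 𝒜
  rw [HomogeneousIdeal.mem_irrelevant_iff, hc, this, map_zero]

lemma lech_of_flat [Fintype σ] (h0 : 𝒜 0 = (1 : Submodule k S)) (hx : ∀ i, x i ∈ 𝒜 1)
    (hli : LinearIndependent k x)
    (m : Ideal S) (hm : m = (HomogeneousIdeal.irrelevant 𝒜).toIdeal)
    (hms : m = Ideal.span (Set.range x)) (Q : ℕ) (F : S →+* S) (hF : ∀ s, F s = s ^ Q)
    (hflat : F.Flat) : LechIndep (fun i => x i ^ Q) := by
  intro a ha i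
  obtain ⟨κ, A, y, h1, h2⟩ := flat_rel F hflat x a (by
    rw [← ha]
    refine Finset.sum_congr rfl fun i _ => ?_
    rw [mul_comm, hF])
  rw [h1 i]
  refine Ideal.sum_mem _ fun j _ => ?_
  have h3 : A i j ∈ Ideal.span (Set.range x) := by
    rw [← hms]
    exact coeff_mem h0 hx hli m hm (fun i => A i j) (h2 j) i
  refine Ideal.mul_mem_right _ _ ?_
  obtain ⟨c, hc⟩ := (Ideal.mem_span_range_iff_exists_fun).1 h3
  rw [← hc, map_sum]
  refine Ideal.sum_mem _ fun l _ => ?_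
  rw [map_mul, hF (x l)]
  exact Ideal.mul_mem_left _ _ (Ideal.subset_span ⟨l, rfl⟩)

lemma flat_iterate (F : S →+* S) (hflat : F.Flat) (q : ℕ) (hF : ∀ s, F s = s ^ q) (N : ℕ) :
    ∃ G : S →+* S, G.Flat ∧ ∀ s, G s = s ^ (q ^ N) := by
  induction N with
  | zero => exact ⟨RingHom.id S, RingHom.Flat.id S, fun s => by simp⟩
  | succ N ih =>
    obtain ⟨G, hG, h⟩ := ih
    exact ⟨G.comp F, hflat.comp hG, fun s => by simp [hF, h, ← pow_mul, pow_succ']⟩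


variable (𝒜) in
noncomputable def modProj (q n : ℕ) : S →ₗ[k] S :=
  (DirectSum.toModule k ℕ S (fun i => if i % q = n then (𝒜 i).subtype else 0)) ∘ₗ
    (DirectSum.decomposeLinearEquiv 𝒜).toLinearMap

lemma modProj_mem {q n i : ℕ} {y : S} (hy : y ∈ 𝒜 i) :
    modProj 𝒜 q n y = if i % q = n then y else 0 := by
  simp only [modProj, LinearMap.comp_apply, LinearEquiv.coe_coe,
    DirectSum.decomposeLinearEquiv_apply]
  rw [DirectSum.decompose_of_mem 𝒜 hy]
  erw [DirectSum.toModule_lof]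
  split_ifs <;> simp

lemma modProj_iSup {q n n' : ℕ} (hn : n < q) {y : S} (hy : y ∈ ⨆ i : ℕ, 𝒜 (i * q + n)) :
    modProj 𝒜 q n' y = if n = n' then y else 0 := by
  induction hy using Submodule.iSup_induction' with
  | mem i y hy =>
    rw [modProj_mem hy, mul_comm i q, Nat.mul_add_mod, Nat.mod_eq_of_lt hn]
  | zero => simp
  | add y z _ _ hy hz => 
    rw [map_add, hy, hz]; split_ifs <;> simp

lemma frob_mem (q n : ℕ) (F : S →+* S) (hF : ∀ s, F s = s ^ q) (c : S) {i : ℕ} {y : S}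
    (hy : y ∈ 𝒜 (i * q + n)) : F c * y ∈ ⨆ i : ℕ, 𝒜 (i * q + n) := by
  induction c using DirectSum.Decomposition.inductionOn 𝒜 with
  | zero => simp
  | add a b ha hb => rw [map_add, add_mul]; exact Submodule.add_mem _ ha hb
  | @homogeneous j a =>
    have h1 : (a : S) ^ q ∈ 𝒜 (q • j) := SetLike.pow_mem_graded q a.2
    have h2 := SetLike.mul_mem_graded h1 hy
    have e : q • j + (i * q + n) = (j + i) * q + n := by rw [smul_eq_mul]; ring
    rw [e] at h2
    rw [hF]
    exact Submodule.mem_iSup_of_mem (j + i) h2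

lemma flat_of_free (q : ℕ) (hq : 0 < q) (F : S →+* S) (hF : ∀ s, F s = s ^ q)
    (H : ∀ n, n < q →
        ∃ (ι : Type v) (b : ι → S),
          (∀ t, ∃ i : ℕ, b t ∈ 𝒜 (i * q + n)) ∧
          (∀ x ∈ ⨆ i : ℕ, 𝒜 (i * q + n), ∃ f : ι →₀ S,
            x = ∑ t ∈ f.support, (f t) ^ q * b t) ∧
          (∀ f g : ι →₀ S,
            (∑ t ∈ f.support, (f t) ^ q * b t) = ∑ t ∈ g.support, (g t) ^ q * b t →
              f = g)) : F.Flat := by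
  classical
  choose ι b hb hs hi using fun n : Fin q => H n n.2
  have hadd : ∀ f g : (Σ n, ι n) →₀ S, ((f + g).sum fun t c => F c * b t.1 t.2) =
      (f.sum fun t c => F c * b t.1 t.2) + g.sum fun t c => F c * b t.1 t.2 := by
    intro f g
    exact Finsupp.sum_add_index' (fun t => by simp) (fun t c d => by rw [map_add, add_mul])
  refine flat_of_basis F (κ := Σ n, ι n) (fun t => b t.1 t.2) ?_ ?_
  · intro x
    induction x using DirectSum.Decomposition.inductionOn 𝒜 with
    | zero => exact ⟨0, by simp⟩
    | add y z hy hz =>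
      obtain ⟨f, rfl⟩ := hy
      obtain ⟨g, rfl⟩ := hz
      exact ⟨f + g, (hadd f g).symm⟩
    | @homogeneous j y =>
      let n : Fin q := ⟨j % q, Nat.mod_lt _ hq⟩
      have hy : (y : S) ∈ ⨆ i : ℕ, 𝒜 (i * q + n) := by
        refine Submodule.mem_iSup_of_mem (j / q) ?_
        have : j / q * q + (n : ℕ) = j := Nat.div_add_mod' j q
        rw [this]
        exact y.2
      obtain ⟨f, hf⟩ := hs n y hy
      refine ⟨f.embDomain ⟨Sigma.mk n, sigma_mk_injective⟩, ?_⟩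
      rw [Finsupp.sum_embDomain, hf]
      exact Finset.sum_congr rfl fun t _ => by simp only [hF]; rfl
  · intro f hf
    rw [Finsupp.sigma_sum] at hf
    have hmem : ∀ n : Fin q, ((f.split n).sum fun t c => F c * b n t) ∈
        ⨆ i : ℕ, 𝒜 (i * q + n) := by
      intro n
      refine Submodule.sum_mem _ fun t _ => ?_
      obtain ⟨i, hi⟩ := hb n t
      exact frob_mem q n F hF _ hi
    have hz : ∀ n : Fin q, f.split n = 0 := by
      intro n
      apply hi n
      simp only [Finsupp.support_zero, Finset.sum_empty]
      have h1 := congrArg (modProj 𝒜 q n) hf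
      rw [map_sum, map_zero] at h1
      have h2 : ∀ n' : Fin q, modProj 𝒜 q n ((f.split n').sum fun t c => F c * b n' t) =
          if n' = n then ((f.split n).sum fun t c => F c * b n t) else 0 := by
        intro n'
        rw [modProj_iSup n'.2 (hmem n')]
        by_cases h : n' = n
        · subst h; simp
        · rw [if_neg h, if_neg (fun h' => h (Fin.ext h'))]
      simp only [h2] at h1
      rw [Finset.sum_ite_eq'] at h1
      split_ifs at h1 with h3
      · simpa only [Finsupp.sum, hF] using h1
      · rw [Finsupp.mem_splitSupport_iff_nonzero, not_not] at h3
        rw [h3]; simp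
    ext ⟨n, t⟩
    rw [← Finsupp.split_apply, hz n]; rfl


lemma proj_one_mul' [Fintype σ] (hx : ∀ i, x i ∈ 𝒜 1) {a y : S}
    (hy : y ∈ Ideal.span (Set.range x)) :
    GradedRing.proj 𝒜 1 (a * y) = GradedRing.proj 𝒜 0 a * GradedRing.proj 𝒜 1 y := by
  obtain ⟨c, rfl⟩ := (Ideal.mem_span_range_iff_exists_fun).1 hy
  rw [Finset.mul_sum, map_sum, map_sum, Finset.mul_sum]
  refine Finset.sum_congr rfl fun i _ => ?_
  rw [← mul_assoc, proj_one_mul (hx i), proj_one_mul (hx i), ← mul_assoc]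
  congr 1
  exact map_mul (GradedRing.projZeroRingHom 𝒜) a (c i)

lemma card_le_of_span [Fintype σ] (h0 : 𝒜 0 = (1 : Submodule k S)) (hx : ∀ i, x i ∈ 𝒜 1)
    (hli : LinearIndependent k x)
    (m : Ideal S) (hm : m = (HomogeneousIdeal.irrelevant 𝒜).toIdeal)
    (hms : m = Ideal.span (Set.range x)) [m.IsPrime] (s : Finset (Localization.AtPrime m))
    (hs : Ideal.span (s : Set (Localization.AtPrime m)) =
      IsLocalRing.maximalIdeal (Localization.AtPrime m)) :
    Fintype.card σ ≤ s.card := by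
  classical
  choose y hy using fun z : (Localization.AtPrime m) => IsLocalization.surj m.primeCompl z
  have hunit : ∀ z, IsUnit (algebraMap S (Localization.AtPrime m) (y z).2) := fun z =>
    IsLocalization.map_units (Localization.AtPrime m) (y z).2
  have hym : ∀ z ∈ s, (y z).1 ∈ m := by
    intro z hz
    rw [← IsLocalization.AtPrime.to_map_mem_maximal_iff (Localization.AtPrime m) m, ← hy z]
    refine Ideal.mul_mem_right _ _ ?_
    change z ∈ IsLocalRing.maximalIdeal (Localization.AtPrime m)
    rw [← hs]
    exact Ideal.subset_span hz
  set T : Set S := (fun z => (y z).1) '' (s : Set (Localization.AtPrime m)) with hT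
  have hle : IsLocalRing.maximalIdeal (Localization.AtPrime m) ≤
      Ideal.map (algebraMap S (Localization.AtPrime m)) (Ideal.span T) := by
    rw [← hs, Ideal.span_le]
    intro z hz
    have h1 : algebraMap S (Localization.AtPrime m) (y z).1 ∈ Ideal.map (algebraMap S (Localization.AtPrime m)) (Ideal.span T) :=
      Ideal.mem_map_of_mem _ (Ideal.subset_span ⟨z, hz, rfl⟩)
    rw [← hy z] at h1
    exact (Ideal.mul_unit_mem_iff_mem _ (hunit z)).1 h1
  set W : Finset S := s.image fun z => GradedRing.proj 𝒜 1 (y z).1 with hW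
  have hTW : ∀ t ∈ Ideal.span T, GradedRing.proj 𝒜 1 t ∈ Submodule.span k (W : Set S) := by
    intro t ht
    refine Submodule.span_induction (p := fun t _ => ∀ a : S,
      GradedRing.proj 𝒜 1 (a * t) ∈ Submodule.span k (W : Set S)) ?_ ?_ ?_ ?_ ht 1
      |> fun h => by simpa using h
    · rintro _ ⟨z, hz, rfl⟩ a
      obtain ⟨c, hc⟩ := exists_proj_zero (𝒜 := 𝒜) h0 a
      rw [proj_one_mul' hx (hms ▸ hym z hz), hc, ← Algebra.smul_def]
      refine Submodule.smul_mem _ _ (Submodule.subset_span ?_)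
      rw [hW, Finset.coe_image]
      exact ⟨z, hz, rfl⟩
    · intro a; simp
    · intro t t' _ _ h h' a
      rw [mul_add, map_add]
      exact Submodule.add_mem _ (h a) (h' a)
    · intro r t _ h a
      rw [smul_eq_mul, ← mul_assoc]
      exact h _
  have hxW : Submodule.span k (Set.range x) ≤ Submodule.span k (W : Set S) := by
    rw [Submodule.span_le]
    rintro _ ⟨i, rfl⟩
    have h1 : algebraMap S (Localization.AtPrime m) (x i) ∈ Ideal.map (algebraMap S (Localization.AtPrime m)) (Ideal.span T) := by
      apply hle
      rw [IsLocalization.AtPrime.to_map_mem_maximal_iff (Localization.AtPrime m) m, hms]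
      exact Ideal.subset_span ⟨i, rfl⟩
    rw [IsLocalization.algebraMap_mem_map_algebraMap_iff m.primeCompl] at h1
    obtain ⟨u, hu, hux⟩ := h1
    have h2 := hTW _ hux
    obtain ⟨c, hc⟩ := exists_proj_zero (𝒜 := 𝒜) h0 u
    rw [proj_one_mul (hx i), hc, ← Algebra.smul_def] at h2
    have hc0 : c ≠ 0 := by
      rintro rfl
      apply hu
      rw [hm]
      change u ∈ HomogeneousIdeal.irrelevant 𝒜
      rw [HomogeneousIdeal.mem_irrelevant_iff, hc, map_zero]
    exact (Submodule.smul_mem_iff _ hc0).1 h2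
  calc Fintype.card σ = Module.finrank k (Submodule.span k (Set.range x)) :=
        (finrank_span_eq_card hli).symm
    _ ≤ Module.finrank k (Submodule.span k (W : Set S)) := Submodule.finrank_mono hxW
    _ ≤ W.card := finrank_span_finset_le_card W
    _ ≤ s.card := Finset.card_image_le

lemma inj_of_regular [Fintype σ] (h0 : 𝒜 0 = (1 : Submodule k S)) (hx : ∀ i, x i ∈ 𝒜 1)
    (hli : LinearIndependent k x) (hadj : Algebra.adjoin k (Set.range x) = ⊤)
    (m : Ideal S) (hm : m = (HomogeneousIdeal.irrelevant 𝒜).toIdeal)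
    (hms : m = Ideal.span (Set.range x)) [m.IsPrime]
    (hreg : IsRegularLocal (Localization.AtPrime m)) :
    Function.Injective (MvPolynomial.aeval x : MvPolynomial σ k →ₐ[k] S) := by
  obtain ⟨-, s, hs, hdim⟩ := hreg
  have hcard := card_le_of_span h0 hx hli m hm hms s hs
  rw [injective_iff_map_eq_zero]
  intro f hf
  by_contra hne
  have h1 := ringKrullDim_succ_le_of_surjective
    (MvPolynomial.aeval x : MvPolynomial σ k →ₐ[k] S).toRingHom (aeval_surj hadj)
    (mem_nonZeroDivisors_of_ne_zero hne) hf
  rw [MvPolynomial.ringKrullDim_of_isNoetherianRing, ringKrullDim_eq_zero_of_field, zero_add,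
    Nat.card_eq_fintype_card] at h1
  rw [IsLocalization.AtPrime.ringKrullDim_eq_height m] at hdim
  have h2 : (m.height : WithBot ℕ∞) ≤ ringKrullDim S := Ideal.height_le_ringKrullDim_of_isPrime
  rw [hdim] at h2
  have h3 : ((s.card + 1 : ℕ) : WithBot ℕ∞) ≤ (Fintype.card σ : ℕ) := by
    push_cast
    exact (add_le_add_left h2 1).trans h1
  have h4 : s.card + 1 ≤ Fintype.card σ := by exact_mod_cast h3
  omega

lemma regular_of_inj [Finite σ] (hadj : Algebra.adjoin k (Set.range x) = ⊤)
    (m : Ideal S) [m.IsPrime]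
    (hinj : Function.Injective (MvPolynomial.aeval x : MvPolynomial σ k →ₐ[k] S)) :
    IsRegularLocal (Localization.AtPrime m) := by
  have : IsRegularRing S := IsRegularRing.of_ringEquiv
    (RingEquiv.ofBijective (MvPolynomial.aeval x : MvPolynomial σ k →ₐ[k] S)
      ⟨hinj, aeval_surj hadj⟩)
  have h1 : IsRegularLocalRing (Localization.AtPrime m) := inferInstance
  have h2 := h1.spanFinrank_maximalIdeal
  refine ⟨inferInstance, ?_⟩
  obtain ⟨s, hs, hs'⟩ := Submodule.FG.exists_span_finset_card_eq_spanFinrank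
    (IsNoetherian.noetherian (IsLocalRing.maximalIdeal (Localization.AtPrime m)))
  exact ⟨s, hs', by rw [← h2, hs]⟩


lemma prod_mem [Fintype σ] (hx : ∀ i, x i ∈ 𝒜 1) (a : σ → ℕ) :
    ∏ i, x i ^ a i ∈ 𝒜 (∑ i, a i) := by
  refine SetLike.prod_mem_graded (A := 𝒜) (fun i => a i) (fun i => x i ^ a i) fun i _ => ?_
  simpa using SetLike.pow_mem_graded (a i) (hx i)

lemma coeff_pow_mul [Fintype σ] (q : ℕ) (hq : 0 < q)
    (hadd : ∀ a b : MvPolynomial σ k, (a + b) ^ q = a ^ q + b ^ q)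
    (hadd' : ∀ a b : k, (a + b) ^ q = a ^ q + b ^ q)
    (a t : σ →₀ ℕ) (ha : ∀ i, a i < q) (ht : ∀ i, t i < q) (r : σ →₀ ℕ) [Decidable (t = a)]
    (g : MvPolynomial σ k) :
    MvPolynomial.coeff (q • r + a) (g ^ q * MvPolynomial.monomial t 1) =
      if t = a then (g.coeff r) ^ q else 0 := by
  classical
  induction g using MvPolynomial.induction_on' with
  | add f g hf hg =>
    rw [hadd, add_mul, MvPolynomial.coeff_add, hf, hg, MvPolynomial.coeff_add, hadd']
    split_ifs <;> simp
  | monomial b c =>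
    rw [MvPolynomial.monomial_pow, MvPolynomial.monomial_mul, mul_one,
      MvPolynomial.coeff_monomial, MvPolynomial.coeff_monomial]
    have key : q • b + t = q • r + a ↔ b = r ∧ t = a := by
      constructor
      · intro h
        have h' : ∀ i, q * b i + t i = q * r i + a i := fun i => by
          simpa using DFunLike.congr_fun h i
        have h1 : t = a := by
          ext i
          have := congrArg (· % q) (h' i)
          simpa [Nat.mul_add_mod, Nat.mod_eq_of_lt (ha i), Nat.mod_eq_of_lt (ht i)] using this
        refine ⟨?_, h1⟩
        ext i
        have := h' i
        rw [h1] at this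
        exact Nat.eq_of_mul_eq_mul_left hq (Nat.add_right_cancel this)
      · rintro ⟨rfl, rfl⟩; rfl
    by_cases h1 : b = r <;> by_cases h2 : t = a <;> simp [key, h1, h2, hq.ne']

lemma free_of_inj {σ : Type v} {x : σ → S} [Fintype σ] (hx : ∀ i, x i ∈ 𝒜 1)
    (hadj : Algebra.adjoin k (Set.range x) = ⊤)
    (hinj : Function.Injective (MvPolynomial.aeval x : MvPolynomial σ k →ₐ[k] S))
    (q : ℕ) (hq : 0 < q)
    (hadd : ∀ a b : MvPolynomial σ k, (a + b) ^ q = a ^ q + b ^ q)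
    (hadd' : ∀ a b : k, (a + b) ^ q = a ^ q + b ^ q)
    (hroot : ∀ c : k, ∃ d : k, d ^ q = c)
    (F : S →+* S) (hF : ∀ s, F s = s ^ q) (n : ℕ) (hn : n < q) :
    ∃ (ι : Type v) (b : ι → S),
      (∀ t, ∃ i : ℕ, b t ∈ 𝒜 (i * q + n)) ∧
      (∀ x ∈ ⨆ i : ℕ, 𝒜 (i * q + n), ∃ f : ι →₀ S,
        x = ∑ t ∈ f.support, (f t) ^ q * b t) ∧
      (∀ f g : ι →₀ S,
        (∑ t ∈ f.support, (f t) ^ q * b t) = ∑ t ∈ g.support, (g t) ^ q * b t →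
          f = g) := by
  classical
  let ι : Type v := {a : σ → Fin q // (∑ i, (a i : ℕ)) % q = n}
  let b : ι → S := fun t => ∏ i, x i ^ (t.1 i : ℕ)
  let Φ : (ι →₀ S) →+ S := Finsupp.liftAddHom
    (fun t => (AddMonoidHom.mulRight (b t)).comp F.toAddMonoidHom)
  have hΦ : ∀ f : ι →₀ S, Φ f = ∑ t ∈ f.support, (f t) ^ q * b t := by
    intro f
    simp [Φ, Finsupp.liftAddHom_apply, Finsupp.sum, hF]
  refine ⟨ι, b, ?_, ?_, ?_⟩
  · intro t
    refine ⟨(∑ i, (t.1 i : ℕ)) / q, ?_⟩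
    have h := prod_mem hx (fun i => (t.1 i : ℕ))
    have e : (∑ i, (t.1 i : ℕ)) / q * q + n = ∑ i, (t.1 i : ℕ) := by
      have h2 := Nat.div_add_mod' (∑ i, (t.1 i : ℕ)) q
      rwa [t.2] at h2
    rw [e]; exact h
  · intro y hy
    have key : ∀ f : MvPolynomial σ k, ∃ g, modProj 𝒜 q n (MvPolynomial.aeval x f) = Φ g := by
      intro f
      induction f using MvPolynomial.induction_on' with
      | add f g hf hg =>
        obtain ⟨f', hf⟩ := hf
        obtain ⟨g', hg⟩ := hg
        exact ⟨f' + g', by rw [map_add, map_add, map_add, hf, hg]⟩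
      | monomial a c =>
        rw [MvPolynomial.aeval_monomial, ← Algebra.smul_def, map_smul,
          Finsupp.prod_fintype _ _ (by simp), modProj_mem (prod_mem hx a)]
        split_ifs with h
        · obtain ⟨d, rfl⟩ := hroot c
          let t : ι := ⟨fun i => ⟨a i % q, Nat.mod_lt _ hq⟩, by
            rw [← h, Finset.sum_nat_mod Finset.univ q a]⟩
          refine ⟨Finsupp.single t (d • ∏ i, x i ^ (a i / q)), ?_⟩
          simp only [Φ, Finsupp.liftAddHom_apply_single, AddMonoidHom.comp_apply]
          change _ = F _ * b t
          rw [hF, smul_pow, smul_mul_assoc, ← Finset.prod_pow, ← Finset.prod_mul_distrib]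
          congr 1
          refine Finset.prod_congr rfl fun i _ => ?_
          rw [← pow_mul, ← pow_add]
          congr 1
          exact (Nat.div_add_mod' _ _).symm
        · exact ⟨0, by simp⟩
    obtain ⟨f, rfl⟩ := aeval_surj hadj y
    obtain ⟨g, hg⟩ := key f
    refine ⟨g, ?_⟩
    rw [← hΦ, ← hg, modProj_iSup hn hy, if_pos rfl]
  · intro f g hfg
    rw [← hΦ, ← hΦ, ← sub_eq_zero, ← map_sub] at hfg
    rw [← sub_eq_zero]
    generalize f - g = h at hfg
    rw [hΦ] at hfg
    choose G hG using fun t : ι => aeval_surj hadj (h t)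
    let T : ι → σ →₀ ℕ := fun t => Finsupp.equivFunOnFinite.symm (fun i => (t.1 i : ℕ))
    have hT : ∀ t i, T t i < q := fun t i => (t.1 i).2
    have hTinj : Function.Injective T := by
      intro t t' htt
      apply Subtype.ext
      funext i
      apply Fin.ext
      exact DFunLike.congr_fun htt i
    have hzero : ∑ t ∈ h.support, (G t) ^ q * MvPolynomial.monomial (T t) 1 = 0 := by
      apply hinj
      rw [map_zero, map_sum, ← hfg]
      refine Finset.sum_congr rfl fun t _ => ?_
      rw [map_mul, map_pow, hG, MvPolynomial.aeval_monomial, map_one, one_mul,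
        Finsupp.prod_fintype _ _ (by simp)]
      rfl
    ext t
    by_contra ht
    have htm : t ∈ h.support := Finsupp.mem_support_iff.2 ht
    apply ht
    rw [← hG]
    suffices G t = 0 by rw [this, map_zero]; rfl
    ext r
    have h1 := congrArg (MvPolynomial.coeff (q • r + T t)) hzero
    rw [MvPolynomial.coeff_sum] at h1
    simp only [coeff_pow_mul q hq hadd hadd' (T t) _ (hT t) (hT _), hTinj.eq_iff] at h1
    rw [Finset.sum_ite_eq', if_pos htm] at h1
    simpa [hq.ne'] using h1

end
end GK


/-- Graded Kunz theorem: for a standard graded algebra `S` over a perfect field `k` of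
characteristic `p > 0`, with `q = p^e`, the localization `S_𝔪` at the irrelevant maximal
ideal is regular if and only if for every `n < q` the `S`-module
`S^{(n)} = ⊕_{i ≥ 0} S_{iq+n}` (with `S` acting through the `e`-th Frobenius,
`s • x = s^q * x`) is free on a basis of homogeneous elements. Freeness is expressed by
the existence of a family `b : ι → S` of homogeneous elements of `S^{(n)}` such that every
element of `S^{(n)}` is written as `∑ (f t)^q * b t` for a unique finitely supported
`f : ι →₀ S`. -/
theorem standard_graded_kunz.{u, v} {k : Type u} {S : Type v} [Field k] [CommRing S]
    [Algebra k S] (p : ℕ) (hp : p.Prime) [ExpChar k p] [PerfectRing k p]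
    (𝒜 : ℕ → Submodule k S) [GradedAlgebra 𝒜]
    (h0 : 𝒜 0 = (1 : Submodule k S))
    (hgen : ∃ s : Finset S, (s : Set S) ⊆ (𝒜 1 : Set S) ∧ Algebra.adjoin k (s : Set S) = ⊤)
    (m : Ideal S) (hm : m = (HomogeneousIdeal.irrelevant 𝒜).toIdeal) [m.IsMaximal]
    (e : ℕ) (he : 1 ≤ e) (q : ℕ) (hq : q = p ^ e) :
    IsRegularLocal (Localization.AtPrime m) ↔
      ∀ n, n < q →
        ∃ (ι : Type v) (b : ι → S),
          (∀ t, ∃ i : ℕ, b t ∈ 𝒜 (i * q + n)) ∧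
          (∀ x ∈ ⨆ i : ℕ, 𝒜 (i * q + n), ∃ f : ι →₀ S,
            x = ∑ t ∈ f.support, (f t) ^ q * b t) ∧
          (∀ f g : ι →₀ S,
            (∑ t ∈ f.support, (f t) ^ q * b t) = ∑ t ∈ g.support, (g t) ^ q * b t →
              f = g) := by
  subst hq
  have hmax : m.IsMaximal := inferInstance
  have : m.IsPrime := hmax.isPrime
  have : Nontrivial S := ⟨0, 1, fun h => hmax.ne_top (m.eq_top_iff_one.2 (h ▸ m.zero_mem))⟩
  have : ExpChar S p := expChar_of_injective_algebraMap (algebraMap k S).injective p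
  obtain ⟨σ, _, x, hx, hli, hadj⟩ := GK.exists_gens 𝒜 hgen
  have hms := GK.m_eq_span hx hadj m hm hmax
  have hq : 0 < p ^ e := pow_pos hp.pos e
  have hF : ∀ s : S, iterateFrobenius S p e s = s ^ (p ^ e) := fun s => iterateFrobenius_def p e s
  constructor
  · intro hreg n hn
    have hinj := GK.inj_of_regular h0 hx hli hadj m hm hms hreg
    refine GK.free_of_inj hx hadj hinj (p ^ e) hq (fun a b => add_pow_expChar_pow a b p e)
      (fun a b => add_pow_expChar_pow a b p e) (fun c => ?_) (iterateFrobenius S p e) hF n hn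
    exact (bijective_iterateFrobenius k p e).2 c
  · intro H
    have hflat := GK.flat_of_free (p ^ e) hq (iterateFrobenius S p e) hF H
    have h1 : 1 < p ^ e := Nat.one_lt_pow (by omega) hp.one_lt
    refine GK.regular_of_inj hadj m (GK.aeval_inj (k := k) ?_ ?_)
    · intro a
      obtain ⟨G, hG, hG'⟩ := GK.flat_iterate _ hflat (p ^ e) hF (∑ i, a i)
      refine (GK.lech_of_flat h0 hx hli m hm hms _ G hG' hG).pow a fun i => ?_
      exact (Finset.single_le_sum (fun _ _ => Nat.zero_le _) (Finset.mem_univ i)).trans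
        (Nat.lt_pow_self h1).le
    · rw [← hms]
      exact fun h => hmax.ne_top (m.eq_top_iff_one.2 h)
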